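/- arXiv:1311.2529 — 3 statements merged into one kernel-verified Lean document; each statement's English description precedes it below -/
import Mathlib

section
/- Let G be a finite group and let C0, C1, C∞ be conjugacy classes in G with chosen representatives c0, c1, c∞. Then the number of triples (σ0, σ1, σ∞) ∈ C0 × C1 × C∞ with σ0 σ1 σ∞ = 1 equals (#C0 · #C1 · #C∞ / #G) · Σ_χ χ(c0) χ(c1) χ(c∞) / χ(1), where the sum ranges over the irreducible complex characters χ of G (one for each isomorphism class of irreducible complex representation). -/
open CategoryTheory

universe u

namespace FDRep

variable {k : Type u} [Field k] {G : Type u} [Group G]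

theorem char_one_ne_zero [CharZero k] (V : FDRep k G) [Simple V] : V.character 1 ≠ 0 := by
  rw [char_one, Nat.cast_ne_zero]
  intro h
  have := Module.finrank_zero_iff.mp h
  apply id_nonzero V
  ext x
  exact Subsingleton.elim (α := V) _ _

variable [IsAlgClosed k]

/-- Schur's lemma: a linear endomorphism commuting with an irreducible representation is a
scalar. -/
theorem exists_eq_smul_one_of_commute (V : FDRep k G) [Simple V] (T : V →ₗ[k] V)
    (hT : ∀ g, T ∘ₗ V.ρ g = V.ρ g ∘ₗ T) : ∃ c : k, T = c • (1 : V →ₗ[k] V) := by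
  let t : V ⟶ V := ⟨InducedCategory.homMk (ModuleCat.ofHom T), fun g ↦ by
    ext x
    exact LinearMap.congr_fun (hT g) x⟩
  obtain ⟨c, hc⟩ := (finrank_eq_one_iff_of_nonzero' (𝟙 V) (id_nonzero V)).mp
    (finrank_endomorphism_simple_eq_one k V) t
  refine ⟨c, LinearMap.ext fun x ↦ ?_⟩
  exact (ConcreteCategory.congr_hom (congrArg Action.Hom.hom hc) x).symm

variable [Fintype G]

/-- The element of the group algebra given by a class function acts on an irreducible
representation as a scalar, which is determined by its trace. -/
theorem char_one_smul_sum_smul_ρ (V : FDRep k G) [Simple V] (φ : G → k)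
    (hφ : ∀ g h, φ (h * g * h⁻¹) = φ g) :
    V.character 1 • ∑ g, φ g • V.ρ g = (∑ g, φ g * V.character g) • (1 : V →ₗ[k] V) := by
  obtain ⟨c, hc⟩ := V.exists_eq_smul_one_of_commute (∑ g, φ g • V.ρ g) fun h ↦ by
    change (∑ g, φ g • V.ρ g) * V.ρ h = V.ρ h * ∑ g, φ g • V.ρ g
    rw [Finset.sum_mul, Finset.mul_sum]
    refine (Fintype.sum_equiv (MulAut.conj h).toEquiv _ _ fun g ↦ ?_).symm
    simp [hφ, ← map_mul]
  have htrace := congrArg (LinearMap.trace k V) hc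
  simp only [map_sum, map_smul, smul_eq_mul, LinearMap.trace_one] at htrace
  rw [hc, smul_smul, char_one, mul_comm, ← htrace]
  rfl

variable [CharZero k]

theorem sum_smul_ρ_eq_zero (V : FDRep k G) [Simple V] (φ : G → k)
    (hφ : ∀ g h, φ (h * g * h⁻¹) = φ g) (h0 : ∑ g, φ g * V.character g = 0) :
    ∑ g, φ g • V.ρ g = 0 := by
  have h := V.char_one_smul_sum_smul_ρ φ hφ
  rw [h0, zero_smul] at h
  exact (smul_eq_zero.mp h).resolve_left V.char_one_ne_zero

theorem simple_of_isIrreducible {W : Type u} [AddCommGroup W] [Module k W]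
    [Module.Finite k W] (ρ : Representation k G W) [ρ.IsIrreducible] : Simple (FDRep.of ρ) := by
  have := invertibleOfNonzero (NeZero.ne (Nat.card G : k))
  have h := Representation.char_orthonormal ρ ρ
  rw [if_pos ⟨Representation.Equiv.refl ρ⟩, inv_mul_eq_one₀ (NeZero.ne _)] at h
  exact (simple_iff_char_is_norm_one _).mpr h.symm

open MonoidAlgebra in
theorem asAlgebraHom_sum_single_apply_eq_zero {W : Type u} [AddCommGroup W] [Module k W]
    [Module.Finite k W] (ρ : Representation k G W) [ρ.IsIrreducible] (φ : G → k)
    (hφ : ∀ g h, φ (h * g * h⁻¹) = φ g)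
    (h0 : ∀ W : FDRep k G, Simple W → ∑ g, φ g * W.character g = 0) (w : W) :
    ρ.asAlgebraHom (∑ g, single g (φ g)) w = 0 := by
  have := simple_of_isIrreducible ρ
  simp only [map_sum, Representation.asAlgebraHom_single]
  exact LinearMap.congr_fun (sum_smul_ρ_eq_zero (FDRep.of ρ) φ hφ (h0 _ this)) w

open MonoidAlgebra in
theorem sum_single_smul_eq_zero {M : Type u} [AddCommGroup M] [Module (MonoidAlgebra k G) M]
    [IsSimpleModule (MonoidAlgebra k G) M] (φ : G → k)
    (hφ : ∀ g h, φ (h * g * h⁻¹) = φ g)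
    (h0 : ∀ W : FDRep k G, Simple W → ∑ g, φ g * W.character g = 0) (n : M) :
    (∑ g, single g (φ g)) • n = 0 := by
  have hirr := (Representation.isSimpleModule_iff_irreducible_ofModule (k := k) (G := G) M).mp ‹_›
  have hfin : Module.Finite k (RestrictScalars k (MonoidAlgebra k G) M) := by
    let := RestrictScalars.moduleOrig k (MonoidAlgebra k G) M
    have : Module.Finite (MonoidAlgebra k G) (RestrictScalars k (MonoidAlgebra k G) M) :=
      inferInstanceAs (Module.Finite (MonoidAlgebra k G) M)
    exact Module.Finite.trans (MonoidAlgebra k G) _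
  have hz := @asAlgebraHom_sum_single_apply_eq_zero k _ G _ _ _ _
    (RestrictScalars k (MonoidAlgebra k G) M) _ (RestrictScalars.module k (MonoidAlgebra k G) M)
    hfin (Representation.ofModule M) hirr φ hφ h0
  have h := Representation.ofModule_asAlgebraHom_apply_apply M (∑ g, single g (φ g))
    ((RestrictScalars.addEquiv k (MonoidAlgebra k G) M).symm n)
  exact h.symm.trans (hz _)

open MonoidAlgebra in
/-- A class function orthogonal to all irreducible characters vanishes. -/
theorem eq_zero_of_forall_simple_sum_eq_zero (φ : G → k)
    (hφ : ∀ g h, φ (h * g * h⁻¹) = φ g)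
    (h0 : ∀ W : FDRep k G, Simple W → ∑ g, φ g * W.character g = 0) : φ = 0 := by
  have he : ∑ g, single g (φ g) ∈
      Module.annihilator (MonoidAlgebra k G) (MonoidAlgebra k G) := by
    rw [← Submodule.annihilator_top, ← IsSemisimpleModule.sSup_simples_eq_top, sSup_eq_iSup',
      Submodule.annihilator_iSup, Submodule.mem_iInf]
    rintro ⟨m, hm⟩
    have : IsSimpleModule (MonoidAlgebra k G) m := hm
    exact Module.mem_annihilator.mpr (sum_single_smul_eq_zero φ hφ h0)
  have he0 : ∑ g, single g (φ g) = 0 := by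
    simpa using Module.mem_annihilator.mp he 1
  classical
  funext g
  have := congrArg (fun x : MonoidAlgebra k G ↦ x.coeff g) he0
  simpa [coeff_sum, Finsupp.single_apply] using this

end FDRep

open FDRep in
/-- Column orthogonality against the identity: the decomposition of the regular character. -/
theorem FDRep.sum_char_one_mul_char {k : Type u} [Field k] [IsAlgClosed k] [CharZero k]
    {G : Type u} [Group G] [Fintype G] [DecidableEq G]
    {ι : Type*} [Fintype ι] (V : ι → FDRep k G)
    (hsimple : ∀ i, Simple (V i))
    (hdistinct : ∀ i j : ι, Nonempty (V i ≅ V j) → i = j)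
    (hcomplete : ∀ W : FDRep k G, Simple W → ∃ i : ι, Nonempty (W ≅ V i)) (g : G) :
    ∑ i, (V i).character 1 * (V i).character g = if g = 1 then (Nat.card G : k) else 0 := by
  classical
  have := invertibleOfNonzero (NeZero.ne (Nat.card G : k))
  have key := eq_zero_of_forall_simple_sum_eq_zero (k := k) (G := G)
    (fun g ↦ ∑ i, (V i).character 1 * (V i).character g⁻¹ - if g = 1 then (Nat.card G : k) else 0)
    (fun g h ↦ by
      have : (h * g * h⁻¹)⁻¹ = h * g⁻¹ * h⁻¹ := by group
      simp [this])
    (fun W hW ↦ by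
      obtain ⟨j, ⟨e⟩⟩ := hcomplete W hW
      have horth (i : ι) : ∑ x, (V j).character x * (V i).character x⁻¹ =
          if i = j then (Nat.card G : k) else 0 := by
        have h := char_orthonormal (V j) (V i)
        rw [inv_mul_eq_iff_eq_mul₀ (NeZero.ne _)] at h
        rw [h]
        by_cases hij : i = j
        · subst hij
          simp [Nonempty.intro (Iso.refl (V i))]
        · rw [if_neg fun ⟨f⟩ ↦ hij (hdistinct i j ⟨f.symm⟩), if_neg hij, mul_zero]
      simp only [char_iso e, sub_mul, Finset.sum_sub_distrib, Finset.sum_mul, ite_mul, zero_mul,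
        Finset.sum_ite_eq', Finset.mem_univ, if_true]
      rw [Finset.sum_comm, sub_eq_zero]
      simp only [mul_assoc, mul_comm ((V _).character _⁻¹), ← Finset.mul_sum, horth]
      simp [mul_comm])
  have h := congrFun key g⁻¹
  simpa [sub_eq_zero] using h

open scoped Classical in
/-- The sum of an irreducible character over the products of three conjugacy classes. -/
theorem FDRep.sum_char_mul_mul {k : Type u} [Field k] [IsAlgClosed k] [CharZero k]
    {G : Type u} [Group G] [Fintype G] (V : FDRep k G) [Simple V] (a b c : G) :
    ∑ x with IsConj a x, ∑ y with IsConj b y, ∑ z with IsConj c z, V.character (x * y * z) =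
      Nat.card {x // IsConj a x} * Nat.card {x // IsConj b x} * Nat.card {x // IsConj c x} *
        (V.character a * V.character b * V.character c) / V.character 1 ^ 2 := by
  have hV := V.char_one_ne_zero
  have hclass (a : G) : ∑ x with IsConj a x, V.ρ x =
      ((Nat.card {x // IsConj a x} : k) * V.character a / V.character 1) •
        (1 : V →ₗ[k] V) := by
    have h := V.char_one_smul_sum_smul_ρ (fun x ↦ if IsConj a x then 1 else 0) fun g h ↦ by
      have : IsConj a (h * g * h⁻¹) ↔ IsConj a g :=
        have hc : IsConj g (h * g * h⁻¹) := isConj_iff.mpr ⟨h, rfl⟩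
        ⟨fun H ↦ H.trans hc.symm, fun H ↦ H.trans hc⟩
      simp only [this]
    have hchar : ∑ x with IsConj a x, V.character x =
        (Nat.card {x // IsConj a x} : k) * V.character a := by
      rw [Finset.sum_congr rfl (g := fun _ ↦ V.character a), Finset.sum_const, nsmul_eq_mul,
        Nat.card_eq_fintype_card, Fintype.card_subtype]
      intro x hx
      obtain ⟨g, rfl⟩ := isConj_iff.mp (Finset.mem_filter.mp hx).2
      exact V.char_conj a g
    simp only [ite_smul, one_smul, zero_smul, ite_mul, one_mul, zero_mul,
      ← Finset.sum_filter, hchar] at h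
    rw [div_eq_inv_mul, mul_smul, ← h, smul_smul, inv_mul_cancel₀ hV, one_smul]
  have hprod : ∑ x with IsConj a x, ∑ y with IsConj b y, ∑ z with IsConj c z, V.ρ (x * y * z) =
      (∑ x with IsConj a x, V.ρ x) * (∑ y with IsConj b y, V.ρ y) *
        ∑ z with IsConj c z, V.ρ z := by
    simp only [map_mul, ← Finset.mul_sum, ← Finset.sum_mul]
  have htrace := congrArg (LinearMap.trace k V) hprod
  rw [hclass, hclass, hclass] at htrace
  simp only [map_sum, smul_mul_smul_comm, one_mul, map_smul, smul_eq_mul, LinearMap.trace_one,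
    ← char_one] at htrace
  refine htrace.trans ?_
  field_simp

/-- Frobenius's formula: for a finite group `G` and conjugacy classes `C0, C1, C∞` with
representatives `c0, c1, c∞`, the number of triples `(σ0, σ1, σ∞) ∈ C0 × C1 × C∞` with
`σ0 σ1 σ∞ = 1` equals `(#C0 · #C1 · #C∞ / #G) · Σ_χ χ(c0)χ(c1)χ(c∞)/χ(1)`, where the sum runs
over the irreducible complex characters of `G` (one for each isomorphism class of irreducible
complex representation, here indexed by a complete irredundant family `V : ι → FDRep ℂ G`). -/
theorem stmt1 {G : Type} [Group G] [Fintype G] (c0 c1 cinf : G)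
    {ι : Type*} [Fintype ι] (V : ι → FDRep ℂ G)
    (hsimple : ∀ i, Simple (V i))
    (hdistinct : ∀ i j : ι, Nonempty (V i ≅ V j) → i = j)
    (hcomplete : ∀ W : FDRep ℂ G, Simple W → ∃ i : ι, Nonempty (W ≅ V i)) :
    (Nat.card {p : G × G × G //
        IsConj c0 p.1 ∧ IsConj c1 p.2.1 ∧ IsConj cinf p.2.2 ∧ p.1 * p.2.1 * p.2.2 = 1} : ℂ) =
      ((Nat.card {x : G // IsConj c0 x} : ℂ) * (Nat.card {x : G // IsConj c1 x} : ℂ) *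
          (Nat.card {x : G // IsConj cinf x} : ℂ) / (Nat.card G : ℂ)) *
        ∑ i : ι, (V i).character c0 * (V i).character c1 * (V i).character cinf /
          (V i).character 1 := by
  classical
  have hreg := FDRep.sum_char_one_mul_char V hsimple hdistinct hcomplete
  have hG : (Nat.card G : ℂ) ≠ 0 := NeZero.ne _
  have hcount : (Nat.card {p : G × G × G //
      IsConj c0 p.1 ∧ IsConj c1 p.2.1 ∧ IsConj cinf p.2.2 ∧ p.1 * p.2.1 * p.2.2 = 1} : ℂ) =
      ∑ x with IsConj c0 x, ∑ y with IsConj c1 y, ∑ z with IsConj cinf z,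
        if x * y * z = 1 then 1 else 0 := by
    rw [Nat.card_eq_fintype_card, Fintype.card_subtype, Finset.card_filter]
    push_cast
    simp only [Fintype.sum_prod_type, Finset.sum_filter, ite_and]
    refine Finset.sum_congr rfl fun x _ ↦ ?_
    split_ifs
    · refine Finset.sum_congr rfl fun y _ ↦ ?_
      split_ifs <;> simp
    · simp
  have hdelta (g : G) : (if g = 1 then 1 else 0 : ℂ) =
      (Nat.card G : ℂ)⁻¹ * ∑ i, (V i).character 1 * (V i).character g := by
    rw [hreg g]
    simp
  rw [hcount]
  simp only [hdelta, ← Finset.mul_sum]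
  have hswap : ∑ x with IsConj c0 x, ∑ y with IsConj c1 y, ∑ z with IsConj cinf z,
      ∑ i, (V i).character 1 * (V i).character (x * y * z) =
      ∑ i, (V i).character 1 * ∑ x with IsConj c0 x, ∑ y with IsConj c1 y,
        ∑ z with IsConj cinf z, (V i).character (x * y * z) := by
    simp only [Finset.mul_sum]
    symm
    rw [Finset.sum_comm]
    refine Finset.sum_congr rfl fun x _ ↦ ?_
    rw [Finset.sum_comm]
    exact Finset.sum_congr rfl fun y _ ↦ Finset.sum_comm
  rw [hswap, Finset.mul_sum, Finset.mul_sum]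
  refine Finset.sum_congr rfl fun i _ ↦ ?_
  have := hsimple i
  have hV := (V i).char_one_ne_zero
  rw [FDRep.sum_char_mul_mul]
  field_simp
end

section
/- The group PSL(2,ℤ) = SL(2,ℤ)/{±I} is isomorphic to the free product (ℤ/2ℤ) ∗ (ℤ/3ℤ) of a cyclic group of order 2 and a cyclic group of order 3. (Equivalently, the triangle group Δ(2,3,∞) = ⟨δ0, δ1 | δ0² = δ1³ = 1⟩ is isomorphic to PSL(2,ℤ).) -/
open Matrix SpecialLinearGroup ModularGroup Monoid
open scoped MatrixGroups Pointwise

/-- The homomorphism from the cyclic group of order `n` sending the generator to `g`. -/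
def cyclicHom {G : Type*} [Group G] (n : ℕ) (g : G) (hg : g ^ n = 1) :
    Multiplicative (ZMod n) →* G :=
  AddMonoidHom.toMultiplicativeLeft
    (ZMod.lift n ⟨zmultiplesHom (Additive G) (Additive.ofMul g), by
      simp [← ofMul_pow, hg]⟩)

lemma cyclicHom_ofAdd_natCast {G : Type*} [Group G] (n : ℕ) (g : G) (hg : g ^ n = 1) (k : ℕ) :
    cyclicHom n g hg (Multiplicative.ofAdd (k : ZMod n)) = g ^ k := by
  have h := ZMod.lift_coe n (A := Additive G)
    ⟨zmultiplesHom (Additive G) (Additive.ofMul g), by simp [← ofMul_pow, hg]⟩ (k : ℤ)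
  rw [Int.cast_natCast] at h
  refine (congrArg Additive.toMul h).trans ?_
  simp [zmultiplesHom_apply]

lemma exists_cyclicHom_eq_pow {G : Type*} [Group G] (n : ℕ) [NeZero n] (g : G) (hg : g ^ n = 1)
    (h : Multiplicative (ZMod n)) (hh : h ≠ 1) :
    ∃ k, 0 < k ∧ k < n ∧ cyclicHom n g hg h = g ^ k := by
  refine ⟨h.toAdd.val, ?_, ZMod.val_lt _, ?_⟩
  · rw [Nat.pos_iff_ne_zero, Ne, ZMod.val_eq_zero]
    exact fun e => hh (by simpa using e)
  · rw [← cyclicHom_ofAdd_natCast n g hg, ZMod.natCast_zmod_val]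
    rfl

/-- Injectivity of a homomorphism on an indexed free product over `Bool` gives injectivity on the
corresponding binary free product. -/
lemma Monoid.Coprod.lift_injective_of_coprodI {H : Bool → Type*} [∀ b, Group (H b)] {G : Type*}
    [Group G] (f : ∀ b, H b →* G) (hf : Function.Injective (CoprodI.lift f)) :
    Function.Injective (Coprod.lift (f false) (f true)) := by
  let φ : Coprod (H false) (H true) →* CoprodI H := Coprod.lift CoprodI.of CoprodI.of
  let ψ : CoprodI H →* Coprod (H false) (H true) :=
    CoprodI.lift (Bool.rec Coprod.inl Coprod.inr)
  have hψφ : ψ.comp φ = MonoidHom.id _ := by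
    ext x <;> simp [φ, ψ]
  have hφ : Function.Injective φ :=
    Function.LeftInverse.injective (g := ψ) (DFunLike.congr_fun hψφ)
  have hcomp : Coprod.lift (f false) (f true) = (CoprodI.lift f).comp φ := by
    ext x <;> simp [φ]
  rw [hcomp]
  exact hf.comp hφ

/-- The product of the two entries of the first column, which is well defined on `PSL(2, ℤ)`. -/
def colProd : PSL(2, ℤ) → ℤ :=
  Quotient.lift (fun g : SL(2, ℤ) => g 0 0 * g 1 0) fun a b hab => by
    obtain ⟨r, hr, hz⟩ := mem_center_iff.mp (QuotientGroup.leftRel_apply.mp hab)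
    have hb : (b : Matrix (Fin 2) (Fin 2) ℤ) = a * Matrix.scalar (Fin 2) r := by
      rw [hz, ← Matrix.SpecialLinearGroup.coe_mul, mul_inv_cancel_left]
    have hr' : r ^ 2 = 1 := by simpa using hr
    simp only [hb, Matrix.scalar_apply, Matrix.mul_diagonal]
    linear_combination -(a 0 0 * a 1 0) * hr'

lemma colProd_mk (g : SL(2, ℤ)) : colProd (QuotientGroup.mk g) = g 0 0 * g 1 0 := rfl

lemma neg_one_mem_center : (-1 : SL(2, ℤ)) ∈ Subgroup.center SL(2, ℤ) :=
  Subgroup.mem_center_iff.mpr fun g => by simp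

lemma mk_S_sq : (QuotientGroup.mk S : PSL(2, ℤ)) ^ 2 = 1 := by
  rw [← QuotientGroup.mk_pow, QuotientGroup.eq_one_iff]
  convert neg_one_mem_center
  decide

lemma mk_S_mul_T_cube : (QuotientGroup.mk (S * T) : PSL(2, ℤ)) ^ 3 = 1 := by
  rw [← QuotientGroup.mk_pow, QuotientGroup.eq_one_iff]
  convert neg_one_mem_center
  decide

lemma colProd_S_mul (x : PSL(2, ℤ)) : colProd (QuotientGroup.mk S * x) = -colProd x := by
  induction x using QuotientGroup.induction_on with
  | H g =>
    rw [← QuotientGroup.mk_mul, colProd_mk, colProd_mk]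
    simp [coe_S, Matrix.SpecialLinearGroup.coe_mul, Matrix.mul_apply,
      Fin.sum_univ_two]
    ring

lemma colProd_S_mul_T_mul_neg {x : PSL(2, ℤ)} (hx : 0 < colProd x) :
    colProd (QuotientGroup.mk (S * T) * x) < 0 := by
  induction x using QuotientGroup.induction_on with
  | H g =>
    rw [colProd_mk] at hx
    rw [← QuotientGroup.mk_mul, colProd_mk]
    simp [coe_S, coe_T, Matrix.SpecialLinearGroup.coe_mul, Matrix.mul_apply,
      Fin.sum_univ_two]
    nlinarith [sq_nonneg (g 1 0)]

lemma colProd_S_mul_T_sq_mul_neg {x : PSL(2, ℤ)} (hx : 0 < colProd x) :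
    colProd (QuotientGroup.mk (S * T) ^ 2 * x) < 0 := by
  induction x using QuotientGroup.induction_on with
  | H g =>
    rw [colProd_mk] at hx
    rw [← QuotientGroup.mk_pow, ← QuotientGroup.mk_mul, colProd_mk]
    simp [coe_S, coe_T, sq, Matrix.SpecialLinearGroup.coe_mul, Matrix.mul_apply,
      Fin.sum_univ_two]
    nlinarith [sq_nonneg (g 0 0)]

/-- The homomorphisms from the cyclic groups of orders `2` and `3` to `PSL(2, ℤ)` given by the
classes of `S` and `S * T`. -/
def cyclicToPSL : ∀ b : Bool, Multiplicative (ZMod (cond b 3 2)) →* PSL(2, ℤ)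
  | false => cyclicHom 2 (QuotientGroup.mk S) mk_S_sq
  | true => cyclicHom 3 (QuotientGroup.mk (S * T)) mk_S_mul_T_cube

lemma coprodI_lift_cyclicToPSL_injective : Function.Injective (CoprodI.lift cyclicToPSL) := by
  refine CoprodI.lift_injective_of_ping_pong cyclicToPSL (Or.inr ⟨true, ?_⟩)
    (fun b => {x : PSL(2, ℤ) | cond b (colProd x < 0) (0 < colProd x)}) ?_ ?_ ?_
  · change 3 ≤ Cardinal.mk (ZMod 3)
    simp
  · have h : colProd (QuotientGroup.mk (S * T * S)) < 0 := by
      rw [colProd_mk]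
      decide
    rintro (_ | _)
    · refine ⟨QuotientGroup.mk S * QuotientGroup.mk (S * T * S), ?_⟩
      simpa [colProd_S_mul] using h
    · exact ⟨_, h⟩
  · rintro (_ | _) (_ | _) hij
    · exact absurd rfl hij
    · exact Set.disjoint_left.mpr fun x (h₁ : 0 < colProd x) (h₂ : colProd x < 0) => by omega
    · exact Set.disjoint_left.mpr fun x (h₁ : colProd x < 0) (h₂ : 0 < colProd x) => by omega
    · exact absurd rfl hij
  · rintro (_ | _) (_ | _) hij h hh
    · exact absurd rfl hij
    · obtain ⟨k, hk, hk', e⟩ := exists_cyclicHom_eq_pow 2 _ mk_S_sq h hh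
      obtain rfl : k = 1 := by omega
      rintro _ ⟨x, hx : colProd x < 0, rfl⟩
      change 0 < colProd (cyclicHom 2 _ mk_S_sq h * x)
      rw [e, pow_one, colProd_S_mul]
      omega
    · obtain ⟨k, hk, hk', e⟩ := exists_cyclicHom_eq_pow 3 _ mk_S_mul_T_cube h hh
      rintro _ ⟨x, hx : 0 < colProd x, rfl⟩
      change colProd (cyclicHom 3 _ mk_S_mul_T_cube h * x) < 0
      rw [e]
      obtain rfl | rfl : k = 1 ∨ k = 2 := by omega
      · rw [pow_one]
        exact colProd_S_mul_T_mul_neg hx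
      · exact colProd_S_mul_T_sq_mul_neg hx
    · exact absurd rfl hij

lemma coprod_lift_cyclicToPSL_surjective :
    Function.Surjective (Coprod.lift (cyclicToPSL false) (cyclicToPSL true)) := by
  set F := Coprod.lift (cyclicToPSL false) (cyclicToPSL true)
  have hS : (QuotientGroup.mk S : PSL(2, ℤ)) ∈ F.range :=
    ⟨Coprod.inl (Multiplicative.ofAdd ((1 : ℕ) : ZMod 2)),
      (cyclicHom_ofAdd_natCast 2 _ mk_S_sq 1).trans (pow_one _)⟩
  have hST : (QuotientGroup.mk (S * T) : PSL(2, ℤ)) ∈ F.range :=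
    ⟨Coprod.inr (Multiplicative.ofAdd ((1 : ℕ) : ZMod 3)),
      (cyclicHom_ofAdd_natCast 3 _ mk_S_mul_T_cube 1).trans (pow_one _)⟩
  have hT : (QuotientGroup.mk T : PSL(2, ℤ)) ∈ F.range := by
    simpa [QuotientGroup.mk_mul] using mul_mem (inv_mem hS) hST
  have hle : Subgroup.closure {S, T} ≤ F.range.comap (QuotientGroup.mk' _) := by
    rw [Subgroup.closure_le]
    rintro _ (rfl | rfl)
    exacts [hS, hT]
  rw [SL2Z_generators] at hle
  intro x
  induction x using QuotientGroup.induction_on with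
  | H g => exact hle (Subgroup.mem_top g)


/-- `PSL(2,ℤ) = SL(2,ℤ)/{±I}` is isomorphic to the free product `(ℤ/2ℤ) ∗ (ℤ/3ℤ)` of cyclic
groups of orders 2 and 3. -/
theorem stmt8 :
    Nonempty
      ((Matrix.SpecialLinearGroup (Fin 2) ℤ ⧸
          Subgroup.center (Matrix.SpecialLinearGroup (Fin 2) ℤ)) ≃*
        Monoid.Coprod (Multiplicative (ZMod 2)) (Multiplicative (ZMod 3))) := by
  exact ⟨(MulEquiv.ofBijective (Coprod.lift (cyclicToPSL false) (cyclicToPSL true))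
    ⟨Coprod.lift_injective_of_coprodI cyclicToPSL coprodI_lift_cyclicToPSL_injective,
      coprod_lift_cyclicToPSL_surjective⟩).symm⟩
end

section
/- Consider triples (σ0, σ1, σ∞) of permutations of a 7-element set satisfying σ0 σ1 σ∞ = 1, where σ0 has cycle type 2³1¹ (three 2-cycles and one fixed point), σ1 has cycle type 3²1¹ (two 3-cycles and one fixed point), σ∞ has cycle type 6¹1¹ (one 6-cycle and one fixed point), and the subgroup generated by σ0, σ1, σ∞ acts transitively on the 7 points. Then: (a) up to simultaneous conjugation in S₇ there are exactly two such triples; and (b) for every such triple, the subgroup of S₇ generated by σ0, σ1, σ∞ has order 42 (it is the Frobenius group of order 42). -/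
open Equiv in
/-- The `6`-cycle `(0 1 2 3 4 5)` on seven points. -/
def sixCycle : Perm (Fin 7) :=
  swap 0 1 * swap 1 2 * swap 2 3 * swap 3 4 * swap 4 5

open Equiv in
/-- The involution `(0 6)(1 5)(u v)`. -/
def involution (u v : Fin 7) : Perm (Fin 7) :=
  swap 0 6 * swap 1 5 * swap u v

/-- A finite group generated by `r` and `c` of coprime orders, with `c` normalizing `⟨r⟩`, has
order the product of the two orders. -/
theorem card_closure_pair_of_coprime_orderOf {G : Type*} [Group G] [Finite G] {r c : G} {k : ℕ}
    (hcop : (orderOf r).Coprime (orderOf c)) (h : c * r = r ^ k * c) :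
    Nat.card (Subgroup.closure {r, c}) = orderOf r * orderOf c := by
  have hcr : ∀ i : ℕ, c * r ^ i = r ^ (k * i) * c := fun i => by
    have h' : SemiconjBy c r (r ^ k) := h
    simpa [pow_mul, SemiconjBy] using h'.pow_right i
  have hform : ∀ g ∈ Subgroup.closure {r, c}, ∃ i j : ℕ, g = r ^ i * c ^ j := by
    intro g hg
    rw [← Subgroup.mem_toSubmonoid, Subgroup.closure_toSubmonoid_of_finite] at hg
    induction hg using Submonoid.closure_induction_left with
    | one => exact ⟨0, 0, by simp⟩
    | mul_left x hx y _ ih =>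
      obtain ⟨i, j, rfl⟩ := ih
      rcases hx with rfl | rfl
      · exact ⟨i + 1, j, by rw [pow_succ', mul_assoc]⟩
      · exact ⟨k * i, j + 1, by rw [← mul_assoc, hcr, pow_succ', mul_assoc]⟩
  have hr : r ∈ Subgroup.closure {r, c} := Subgroup.subset_closure (by simp)
  have hc : c ∈ Subgroup.closure {r, c} := Subgroup.subset_closure (by simp)
  refine le_antisymm ?_ (Nat.le_of_dvd Nat.card_pos (hcop.mul_dvd_of_dvd_of_dvd
    (Subgroup.orderOf_dvd_natCard _ hr) (Subgroup.orderOf_dvd_natCard _ hc)))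
  let f : Fin (orderOf r) × Fin (orderOf c) → Subgroup.closure {r, c} := fun p =>
    ⟨r ^ p.1.1 * c ^ p.2.1, mul_mem (pow_mem hr _) (pow_mem hc _)⟩
  have hf : Function.Surjective f := by
    rintro ⟨g, hg⟩
    obtain ⟨i, j, rfl⟩ := hform g hg
    exact ⟨(⟨i % orderOf r, Nat.mod_lt _ (orderOf_pos r)⟩,
      ⟨j % orderOf c, Nat.mod_lt _ (orderOf_pos c)⟩), Subtype.ext (by simp [f, pow_mod_orderOf])⟩
  simpa using Nat.card_le_card_of_surjective f hf

/-- The triple `(a, (c a)⁻¹, c)` generates the same subgroup as `a c³` and `c`. -/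
theorem closure_triple_eq_closure_pair {G : Type*} [Group G] (a c : G) :
    Subgroup.closure {a, a⁻¹ * c⁻¹, c} = Subgroup.closure {a * c ^ 3, c} := by
  apply le_antisymm <;> rw [Subgroup.closure_le]
  · have hr : a * c ^ 3 ∈ Subgroup.closure {a * c ^ 3, c} := Subgroup.subset_closure (by simp)
    have hc : c ∈ Subgroup.closure {a * c ^ 3, c} := Subgroup.subset_closure (by simp)
    have ha : a ∈ Subgroup.closure {a * c ^ 3, c} := by
      simpa using mul_mem hr (inv_mem (pow_mem hc 3))
    rintro x (rfl | rfl | rfl)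
    exacts [ha, mul_mem (inv_mem ha) (inv_mem hc), hc]
  · have ha : a ∈ Subgroup.closure {a, a⁻¹ * c⁻¹, c} := Subgroup.subset_closure (by simp)
    have hc : c ∈ Subgroup.closure {a, a⁻¹ * c⁻¹, c} := Subgroup.subset_closure (by simp)
    rintro x (rfl | rfl)
    exacts [mul_mem ha (pow_mem hc 3), hc]

/-- Simultaneous conjugation does not change the order of the generated subgroup. -/
theorem card_closure_conj_triple {G : Type*} [Group G] (t a b c : G) :
    Nat.card (Subgroup.closure {t * a * t⁻¹, t * b * t⁻¹, t * c * t⁻¹}) =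
      Nat.card (Subgroup.closure {a, b, c}) := by
  have h : Subgroup.closure {t * a * t⁻¹, t * b * t⁻¹, t * c * t⁻¹} =
      (Subgroup.closure {a, b, c}).map (MulAut.conj t).toMonoidHom := by
    rw [MonoidHom.map_closure]
    simp [Set.image_insert_eq]
  rw [h]
  exact (Nat.card_congr ((Subgroup.closure {a, b, c}).equivMapOfInjective _
    (MulAut.conj t).injective).toEquiv).symm

theorem cycleType_sixCycle : sixCycle.cycleType = {6} := by decide +kernel

theorem cycleType_involution {u v : Fin 7} (h : (u, v) = (3, 4) ∨ (u, v) = (2, 3)) :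
    (involution u v).cycleType = {2, 2, 2} ∧
      ((involution u v)⁻¹ * sixCycle⁻¹).cycleType = {3, 3} ∧
      (involution u v * sixCycle ^ 3).cycleType = {7} := by
  rcases h with h | h <;> obtain ⟨rfl, rfl⟩ := Prod.mk.inj h <;> decide +kernel

theorem card_closure_involution {u v : Fin 7} (h : (u, v) = (3, 4) ∨ (u, v) = (2, 3)) :
    Nat.card (Subgroup.closure {involution u v, (involution u v)⁻¹ * sixCycle⁻¹, sixCycle}) =
      42 := by
  have hr : orderOf (involution u v * sixCycle ^ 3) = 7 := by
    rw [← Equiv.Perm.lcm_cycleType, (cycleType_involution h).2.2]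
    rfl
  have hc : orderOf sixCycle = 6 := by
    rw [← Equiv.Perm.lcm_cycleType, cycleType_sixCycle]
    rfl
  obtain ⟨k, hk⟩ : ∃ k : ℕ, sixCycle * (involution u v * sixCycle ^ 3) =
      (involution u v * sixCycle ^ 3) ^ k * sixCycle := by
    rcases h with h | h <;> obtain ⟨rfl, rfl⟩ := Prod.mk.inj h
    · exact ⟨5, by decide +kernel⟩
    · exact ⟨3, by decide +kernel⟩
  rw [closure_triple_eq_closure_pair,
    card_closure_pair_of_coprime_orderOf (by rw [hr, hc]; decide) hk, hr, hc]

theorem closure_involution_transitive {u v : Fin 7} (h : (u, v) = (3, 4) ∨ (u, v) = (2, 3))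
    (x y : Fin 7) :
    ∃ g ∈ Subgroup.closure {involution u v, (involution u v)⁻¹ * sixCycle⁻¹, sixCycle},
      g x = y := by
  have hpow : ∀ x y : Fin 7, ∃ k : Fin 7, ((involution u v * sixCycle ^ 3) ^ k.1) x = y := by
    rcases h with h | h <;> obtain ⟨rfl, rfl⟩ := Prod.mk.inj h <;> decide +kernel
  obtain ⟨k, hk⟩ := hpow x y
  rw [closure_triple_eq_closure_pair]
  exact ⟨_, pow_mem (Subgroup.subset_closure (by simp)) _, hk⟩

/-- In a transitive triple with product `1`, the first and last entries share no fixed point. -/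
theorem not_transitive_of_common_fixed_point {a b c : Equiv.Perm (Fin 7)} (habc : a * b * c = 1)
    (htrans : ∀ x y : Fin 7, ∃ g ∈ Subgroup.closure {a, b, c}, g x = y) {x : Fin 7}
    (hc : c x = x) : a x ≠ x := by
  intro ha
  have hb : b x = x := by
    have h := congrArg (fun g : Equiv.Perm (Fin 7) => g x) habc
    simp only [Equiv.Perm.mul_apply, hc, Equiv.Perm.one_apply] at h
    exact a.injective (h.trans ha.symm)
  have hle : Subgroup.closure {a, b, c} ≤ MulAction.stabilizer (Equiv.Perm (Fin 7)) x := by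
    rw [Subgroup.closure_le]
    rintro g (rfl | rfl | rfl) <;> simpa [MulAction.mem_stabilizer_iff]
  obtain ⟨y, hy⟩ := exists_ne x
  obtain ⟨g, hg, hgx⟩ := htrans x y
  exact hy (hgx.symm.trans (MulAction.mem_stabilizer_iff.mp (hle hg)))

/-- An involution of type `2³1¹` that sends `6` to `0` and whose product with the `6`-cycle has
order `3` is one of two. -/
theorem eq_involution_of_apply_six {a : Equiv.Perm (Fin 7)} (ha : a.cycleType = {2, 2, 2})
    (h3 : (sixCycle * a) ^ 3 = 1) (h6 : a 6 = 0) :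
    a = involution 3 4 ∨ a = involution 2 3 := by
  have hsq : ∀ x, a (a x) = x := by
    have h : a ^ 2 = 1 := by
      rw [← orderOf_dvd_iff_pow_eq_one, ← Equiv.Perm.lcm_cycleType, ha]
      decide
    intro x
    simpa [sq] using congrArg (fun g : Equiv.Perm (Fin 7) => g x) h
  have hcube : ∀ x, sixCycle (a (sixCycle (a (sixCycle (a x))))) = x := by
    intro x
    simpa [pow_succ] using congrArg (fun g : Equiv.Perm (Fin 7) => g x) h3
  have h0 : a 0 = 6 := by rw [← h6, hsq]
  have h1 : a 1 = 5 := by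
    have h := hcube 0
    rw [h0, show sixCycle 6 = 6 by decide, h6, show sixCycle 0 = 1 by decide] at h
    exact sixCycle.injective (h.trans (by decide))
  have h5 : a 5 = 1 := by rw [← h1, hsq]
  have hmem : ∀ x : Fin 7, x = 2 ∨ x = 3 ∨ x = 4 → a x = 2 ∨ a x = 3 ∨ a x = 4 := by
    intro x hx
    have hne : ∀ y z : Fin 7, a y = z → x ≠ z → a x ≠ y := by
      rintro y z h hxz rfl
      exact hxz ((hsq x).symm.trans h)
    have hcases : ∀ x y : Fin 7, x = 2 ∨ x = 3 ∨ x = 4 →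
        (x ≠ 6 → y ≠ 0) → (x ≠ 5 → y ≠ 1) → (x ≠ 1 → y ≠ 5) → (x ≠ 0 → y ≠ 6) →
          y = 2 ∨ y = 3 ∨ y = 4 := by decide
    exact hcases x (a x) hx (hne 0 6 h0) (hne 1 5 h1) (hne 5 1 h5) (hne 6 0 h6)
  have hinj : ∀ {x y z : Fin 7}, a x = z → a y = z → x = y := fun hx hy =>
    a.injective (hx.trans hy.symm)
  have hext : ∀ b : Equiv.Perm (Fin 7), b 0 = 6 → b 1 = 5 → b 5 = 1 → b 6 = 0 →
      a 2 = b 2 → a 3 = b 3 → a 4 = b 4 → a = b := by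
    intro b b0 b1 b5 b6 h2 h3 h4
    refine Equiv.ext fun x => ?_
    fin_cases x
    exacts [h0.trans b0.symm, h1.trans b1.symm, h2, h3, h4, h5.trans b5.symm, h6.trans b6.symm]
  rcases hmem 2 (by simp) with h2 | h2 | h2
  · rcases hmem 3 (by simp) with h | h | h
    · exact absurd (hinj h h2) (by decide)
    · have hc := hcube 2
      rw [h2, show sixCycle 2 = 3 by decide, h, show sixCycle 3 = 4 by decide] at hc
      rcases hmem 4 (by simp) with h4 | h4 | h4
      · exact absurd (hinj h4 h2) (by decide)
      · exact absurd (hinj h4 h) (by decide)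
      · rw [h4] at hc
        exact absurd hc (by decide)
    · have h4 : a 4 = 3 := by rw [← h, hsq]
      exact Or.inl (hext _ (by decide) (by decide) (by decide) (by decide)
        (h2.trans (by decide)) (h.trans (by decide)) (h4.trans (by decide)))
  · have h : a 3 = 2 := by rw [← h2, hsq]
    rcases hmem 4 (by simp) with h4 | h4 | h4
    · exact absurd (hinj h4 h) (by decide)
    · exact absurd (hinj h4 h2) (by decide)
    · exact Or.inr (hext _ (by decide) (by decide) (by decide) (by decide)
        (h2.trans (by decide)) (h.trans (by decide)) (h4.trans (by decide)))
  · have hc := hcube 2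
    rw [h2, show sixCycle 4 = 5 by decide, h5, show sixCycle 1 = 2 by decide, h2] at hc
    exact absurd hc (by decide)

/-- Every triple as in the theorem is conjugate to one of two standard triples. -/
theorem exists_conj_involution {a b c : Equiv.Perm (Fin 7)} (habc : a * b * c = 1)
    (ha : a.cycleType = {2, 2, 2}) (hb : b.cycleType = {3, 3}) (hc : c.cycleType = {6})
    (htrans : ∀ x y : Fin 7, ∃ g ∈ Subgroup.closure {a, b, c}, g x = y) :
    ∃ u v : Fin 7, ((u, v) = (3, 4) ∨ (u, v) = (2, 3)) ∧ ∃ t : Equiv.Perm (Fin 7),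
      a = t * involution u v * t⁻¹ ∧ b = t * ((involution u v)⁻¹ * sixCycle⁻¹) * t⁻¹ ∧
        c = t * sixCycle * t⁻¹ := by
  obtain ⟨s, hs⟩ := isConj_iff.mp
    (Equiv.Perm.isConj_iff_cycleType_eq.mpr (cycleType_sixCycle.trans hc.symm))
  have hfix : (s⁻¹ * a * s) 6 ≠ 6 := by
    have hcs : c (s 6) = s 6 := by
      rw [← hs]
      simp [show sixCycle 6 = 6 by decide]
    have h := not_transitive_of_common_fixed_point habc htrans hcs
    intro h'
    apply h
    exact Equiv.Perm.inv_eq_iff_eq.mp h'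
  obtain ⟨k, hk⟩ : ∃ k : ℕ, (sixCycle ^ k) 0 = (s⁻¹ * a * s) 6 := by
    have h : ∀ x : Fin 7, x ≠ 6 → ∃ k : Fin 6, (sixCycle ^ k.1) 0 = x := by decide +kernel
    obtain ⟨k, hk⟩ := h _ hfix
    exact ⟨k, hk⟩
  set t := s * sixCycle ^ k with ht
  have hct : c = t * sixCycle * t⁻¹ := by
    rw [← hs, ht]
    group
  have h6 : (t⁻¹ * a * t) 6 = 0 := by
    have hpow : (sixCycle ^ k) 6 = 6 :=
      Equiv.Perm.pow_apply_eq_self_of_apply_eq_self (by decide) k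
    simp only [ht, mul_inv_rev, Equiv.Perm.mul_apply, hpow] at hk ⊢
    rw [← hk]
    simp
  have h3 : (sixCycle * (t⁻¹ * a * t)) ^ 3 = 1 := by
    have hb3 : b ^ 3 = 1 := by
      rw [← orderOf_dvd_iff_pow_eq_one, ← Equiv.Perm.lcm_cycleType, hb]
      decide
    have hcb : c * a = b⁻¹ := by
      rw [eq_inv_iff_mul_eq_one, mul_assoc]
      exact mul_eq_one_comm.mp habc
    have h : sixCycle * (t⁻¹ * a * t) = t⁻¹ * b⁻¹ * t := by
      rw [← hcb, hct]
      group
    have hconj := conj_pow (i := 3) (a := t⁻¹) (b := b⁻¹)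
    rw [inv_inv] at hconj
    rw [h, hconj, inv_pow, hb3]
    simp
  have hat : (t⁻¹ * a * t).cycleType = {2, 2, 2} := by
    rw [← ha]
    simpa using Equiv.Perm.cycleType_conj (σ := a) (τ := t⁻¹)
  have hform : ∀ {u v : Fin 7}, t⁻¹ * a * t = involution u v →
      a = t * involution u v * t⁻¹ ∧ b = t * ((involution u v)⁻¹ * sixCycle⁻¹) * t⁻¹ ∧
        c = t * sixCycle * t⁻¹ := by
    intro u v h
    have hba : b = a⁻¹ * c⁻¹ := by
      rw [eq_inv_mul_iff_mul_eq, ← mul_eq_one_iff_eq_inv]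
      exact habc
    refine ⟨?_, ?_, hct⟩
    · rw [← h]
      group
    · rw [← h, hba, hct]
      group
  rcases eq_involution_of_apply_six hat h3 h6 with h | h
  · exact ⟨3, 4, Or.inl rfl, t, hform h⟩
  · exact ⟨2, 3, Or.inr rfl, t, hform h⟩

/-- The two standard triples are not simultaneously conjugate. -/
theorem not_conj_involution {t : Equiv.Perm (Fin 7)} (hc : sixCycle = t * sixCycle * t⁻¹)
    (ha : involution 2 3 = t * involution 3 4 * t⁻¹) : False := by
  have hc' : ∀ x, sixCycle (t x) = t (sixCycle x) := fun x => by
    have h := congrArg (fun g : Equiv.Perm (Fin 7) => g (t x)) hc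
    simpa using h
  have ha' : ∀ x, involution 2 3 (t x) = t (involution 3 4 x) := fun x => by
    have h := congrArg (fun g : Equiv.Perm (Fin 7) => g (t x)) ha
    simpa using h
  have h6 : t 6 = 6 := by
    have h : ∀ x : Fin 7, sixCycle x = x → x = 6 := by decide
    exact h _ ((hc' 6).trans (congrArg t (by decide)))
  have h0 : t 0 = 0 := by
    have h := ha' 6
    rw [h6, show involution 2 3 6 = 0 by decide, show involution 3 4 6 = 0 by decide] at h
    exact h.symm
  have h2 : t 2 = 2 := by
    have h := hc' (sixCycle 0)
    rw [← hc' 0, h0] at h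
    exact h.symm
  have h := ha' 2
  rw [show involution 3 4 2 = 2 by decide, h2] at h
  exact absurd h (by decide)


/-- Consider transitive permutation triples `(σ0, σ1, σ∞)` of degree 7 with `σ0 σ1 σ∞ = 1`,
where `σ0` has cycle type `2³1¹`, `σ1` has cycle type `3²1¹`, and `σ∞` has cycle type `6¹1¹`.
(a) Up to simultaneous conjugation in `S₇` there are exactly two such triples; and
(b) every such triple generates a subgroup of `S₇` of order 42. -/
theorem stmt15 :
    let P : Equiv.Perm (Fin 7) × Equiv.Perm (Fin 7) × Equiv.Perm (Fin 7) → Prop := fun σ =>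
      σ.1 * σ.2.1 * σ.2.2 = 1 ∧
      σ.1.cycleType = {2, 2, 2} ∧ σ.2.1.cycleType = {3, 3} ∧ σ.2.2.cycleType = {6} ∧
      ∀ x y : Fin 7, ∃ g ∈ Subgroup.closure {σ.1, σ.2.1, σ.2.2}, g x = y
    Nat.card (Quot (fun σ σ' : {σ // P σ} =>
        ∃ τ : Equiv.Perm (Fin 7),
          σ'.1 = (τ * σ.1.1 * τ⁻¹, τ * σ.1.2.1 * τ⁻¹, τ * σ.1.2.2 * τ⁻¹))) = 2 ∧
      ∀ σ : {σ // P σ},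
        Nat.card (Subgroup.closure {σ.1.1, σ.1.2.1, σ.1.2.2}) = 42 := by
  intro P
  have hconj : ∀ σ : {σ // P σ}, ∃ u v : Fin 7, ((u, v) = (3, 4) ∨ (u, v) = (2, 3)) ∧
      ∃ t : Equiv.Perm (Fin 7), σ.1.1 = t * involution u v * t⁻¹ ∧
        σ.1.2.1 = t * ((involution u v)⁻¹ * sixCycle⁻¹) * t⁻¹ ∧
          σ.1.2.2 = t * sixCycle * t⁻¹ := by
    rintro ⟨σ, h1, ha, hb, hc, htrans⟩
    exact exists_conj_involution h1 ha hb hc htrans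
  refine ⟨?_, ?_⟩
  · let T : ∀ u v : Fin 7, (u, v) = (3, 4) ∨ (u, v) = (2, 3) → {σ // P σ} := fun u v h =>
      ⟨(involution u v, (involution u v)⁻¹ * sixCycle⁻¹, sixCycle), by group,
        (cycleType_involution h).1, (cycleType_involution h).2.1, cycleType_sixCycle,
        closure_involution_transitive h⟩
    rw [Nat.card_eq_two_iff]
    refine ⟨Quot.mk _ (T 3 4 (Or.inl rfl)), Quot.mk _ (T 2 3 (Or.inr rfl)), ?_, ?_⟩
    · intro h
      have hequiv : Equivalence (fun σ σ' : {σ // P σ} => ∃ τ : Equiv.Perm (Fin 7),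
          σ'.1 = (τ * σ.1.1 * τ⁻¹, τ * σ.1.2.1 * τ⁻¹, τ * σ.1.2.2 * τ⁻¹)) := by
        refine ⟨fun σ => ⟨1, by simp⟩, ?_, ?_⟩
        · rintro σ σ' ⟨τ, h⟩
          refine ⟨τ⁻¹, ?_⟩
          rw [h]
          simp [mul_assoc]
        · rintro σ σ' σ'' ⟨τ, h⟩ ⟨τ', h'⟩
          refine ⟨τ' * τ, ?_⟩
          rw [h', h]
          simp [mul_assoc]
      obtain ⟨t, ht⟩ := hequiv.eqvGen_iff.mp (Quot.eqvGen_exact h)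
      exact not_conj_involution (congrArg (fun σ => σ.2.2) ht) (congrArg (fun σ => σ.1) ht)
    · refine Set.eq_univ_of_forall fun q => ?_
      induction q using Quot.ind with
      | mk σ =>
        obtain ⟨u, v, huv, t, h1, h2, h3⟩ := hconj σ
        rcases huv with h | h <;> obtain ⟨rfl, rfl⟩ := Prod.mk.inj h
        · exact Or.inl (Quot.sound ⟨t, Prod.ext h1 (Prod.ext h2 h3)⟩).symm
        · exact Or.inr (Quot.sound ⟨t, Prod.ext h1 (Prod.ext h2 h3)⟩).symm
  · intro σ
    obtain ⟨u, v, huv, t, h1, h2, h3⟩ := hconj σ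
    rw [h1, h2, h3, card_closure_conj_triple, card_closure_involution huv]
end
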